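/- For every n ≥ 1 let D_{n,1}, …, D_{n,n} be random variables on a probability space taking values in the non-negative integers, with identical one-dimensional marginals P(D_{n,v} = k) = d_{n,k} (for all v) and identical off-diagonal pair marginals P(D_{n,v} = k and D_{n,w} = ℓ) = d_{n,k,ℓ} (for all v ≠ w), and set Δₙ = max_v D_{n,v}. Assume: (1) there exist numbers d̄_k > 0 (k ≥ 1) and a real 0 < q < 1 with (log d̄_k)/k → log q as k → ∞; (2) for every C > 0 and every δ > 0 there exist K and N such that for all n ≥ N and all integers k, ℓ with K ≤ k ≤ C·log n and K ≤ ℓ ≤ C·log n one has |d_{n,k}/d̄_k − 1| ≤ δ and |d_{n,k,ℓ}/(d̄_k·d̄_ℓ) − 1| ≤ δ; (3) there exist M > 0 and 0 < q̄ < 1 with d_{n,k} ≤ M·q̄^k and d_{n,k,ℓ} ≤ M·q̄^{k+ℓ} for all n, k, ℓ ≥ 1. Then E[Δₙ] is finite for each n and E[Δₙ] / log n → 1/log(1/q) as n → ∞. -/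

import Mathlib

open MeasureTheory Filter

lemma aux_nat_bound {Ω : Type*} [MeasurableSpace Ω] (μ : Measure Ω) [IsFiniteMeasure μ]
    (X : Ω → ℕ) (hX : Measurable X) (g b : ℕ → ℝ) (hg : ∀ k, 0 ≤ g k)
    (hb : ∀ k, g k * (μ {ω | X ω = k}).toReal ≤ b k) (hs : Summable b) :
    Integrable (fun ω => g (X ω)) μ ∧ ∫ ω, g (X ω) ∂μ ≤ ∑' k, b k := by
  have hb0 : ∀ k, 0 ≤ b k := fun k => le_trans (mul_nonneg (hg k) ENNReal.toReal_nonneg) (hb k)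
  have hm : Measurable (fun ω => g (X ω)) := (measurable_of_countable g).comp hX
  have key : ∫⁻ ω, ENNReal.ofReal (g (X ω)) ∂μ ≤ ENNReal.ofReal (∑' k, b k) := by
    have h1 : ∫⁻ ω, ENNReal.ofReal (g (X ω)) ∂μ
        = ∫⁻ k, ENNReal.ofReal (g k) ∂(μ.map X) := by
      rw [lintegral_map (measurable_of_countable _) hX]
    rw [h1, lintegral_countable', ENNReal.ofReal_tsum_of_nonneg hb0 hs]
    refine ENNReal.tsum_le_tsum fun k => ?_
    rw [Measure.map_apply hX (measurableSet_singleton k)]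
    have h2 : μ (X ⁻¹' {k}) = ENNReal.ofReal (μ {ω | X ω = k}).toReal := by
      rw [ENNReal.ofReal_toReal (measure_ne_top _ _)]
      rfl
    rw [h2, ← ENNReal.ofReal_mul (hg k)]
    exact ENNReal.ofReal_le_ofReal (hb k)
  have hint : Integrable (fun ω => g (X ω)) μ := by
    refine ⟨hm.aestronglyMeasurable, ?_⟩
    rw [hasFiniteIntegral_iff_ofReal (Eventually.of_forall fun ω => hg _)]
    exact key.trans_lt ENNReal.ofReal_lt_top
  refine ⟨hint, ?_⟩
  rw [integral_eq_lintegral_of_nonneg_ae (Eventually.of_forall fun ω => hg _)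
    hm.aestronglyMeasurable]
  exact ENNReal.toReal_le_of_le_ofReal (tsum_nonneg hb0) key

lemma aux_summable (β : ℝ) (hβ : 0 < β) :
    Summable (fun k : ℕ => (k : ℝ) * Real.exp (-(β * k))) := by
  have h := summable_pow_mul_geometric_of_norm_lt_one (R := ℝ) 1 (r := Real.exp (-β))
    (by rw [Real.norm_eq_abs, abs_of_pos (Real.exp_pos _)]; rw [← Real.exp_zero]; exact Real.exp_lt_exp.2 (by linarith))
  refine h.congr fun k => ?_
  rw [pow_one, ← Real.exp_nat_mul]
  congr 2
  ring

lemma aux_sup_measurable {Ω : Type*} [MeasurableSpace Ω] {n : ℕ} (D : Fin n → Ω → ℕ)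
    (hD : ∀ v, Measurable (D v)) :
    Measurable (fun ω => ((Finset.univ.sup fun v => D v ω : ℕ) : ℝ)) := by
  have : Measurable (fun ω => (Finset.univ.sup fun v => D v ω : ℕ)) := by
    exact (measurable_of_countable (fun f : Fin n → ℕ => Finset.univ.sup f)).comp
      (measurable_pi_iff.2 hD)
  exact (measurable_of_countable (fun k : ℕ => (k : ℝ))).comp this

lemma aux_sup_integrable {Ω : Type*} [MeasurableSpace Ω] (μ : Measure Ω) {n : ℕ}
    (D : Fin n → Ω → ℕ) (hD : ∀ v, Measurable (D v))
    (hi : ∀ v, Integrable (fun ω => (D v ω : ℝ)) μ) :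
    Integrable (fun ω => ((Finset.univ.sup fun v => D v ω : ℕ) : ℝ)) μ := by
  refine Integrable.mono' (integrable_finsetSum Finset.univ fun v _ => hi v)
    (aux_sup_measurable D hD).aestronglyMeasurable (Eventually.of_forall fun ω => ?_)
  rw [Real.norm_eq_abs, abs_of_nonneg (Nat.cast_nonneg _)]
  have : (Finset.univ.sup fun v => D v ω) ≤ ∑ v, D v ω :=
    Finset.sup_le fun v _ => Finset.single_le_sum (f := fun v => D v ω)
      (fun _ _ => Nat.zero_le _) (Finset.mem_univ v)
  exact_mod_cast this

/-- Upper bound for a fixed size. -/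
lemma aux_upper {Ω : Type*} [MeasurableSpace Ω] (μ : Measure Ω) [IsProbabilityMeasure μ] {n : ℕ}
    (D : Fin n → Ω → ℕ) (hD : ∀ v, Measurable (D v))
    (hi : Integrable (fun ω => ((Finset.univ.sup fun v => D v ω : ℕ) : ℝ)) μ)
    (T : ℝ) (hT : 0 ≤ T) (b : ℕ → ℝ) (hs : Summable b) (hb0 : ∀ k, 0 ≤ b k)
    (hb : ∀ v, ∀ k : ℕ, T < k → k * (μ {ω | D v ω = k}).toReal ≤ b k) :
    ∫ ω, ((Finset.univ.sup fun v => D v ω : ℕ) : ℝ) ∂μ ≤ T + n * ∑' k, b k := by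
  classical
  set g : ℕ → ℝ := fun k => if T < k then (k : ℝ) else 0 with hgdef
  have hg : ∀ k, 0 ≤ g k := fun k => by simp only [hgdef]; split_ifs <;> simp
  have hA := fun v => aux_nat_bound μ (D v) (hD v) g b hg (fun k => by
    simp only [hgdef]; split_ifs with h
    · exact hb v k h
    · simpa using hb0 k) hs
  have hint : Integrable (fun ω => T + ∑ v, g (D v ω)) μ :=
    (integrable_const T).add (integrable_finsetSum Finset.univ fun v _ => (hA v).1)
  calc _ ≤ ∫ ω, (T + ∑ v, g (D v ω)) ∂μ := by
        refine integral_mono hi hint fun ω => ?_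
        have hsum : 0 ≤ ∑ v, g (D v ω) := Finset.sum_nonneg fun v _ => hg _
        show ((Finset.univ.sup fun v => D v ω : ℕ) : ℝ) ≤ T + ∑ v, g (D v ω)
        have : ∀ S : Finset (Fin n), ((S.sup fun v => D v ω : ℕ) : ℝ) ≤ T + ∑ v, g (D v ω) := by
          intro S
          induction S using Finset.induction_on with
          | empty => simp; linarith
          | insert a S _ ih =>
            rw [Finset.sup_insert]
            push_cast
            refine max_le ?_ ih
            have h1 : g (D a ω) ≤ ∑ v, g (D v ω) :=
              Finset.single_le_sum (f := fun v => g (D v ω)) (fun v _ => hg _) (Finset.mem_univ a)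
            have h2 : (D a ω : ℝ) ≤ T + g (D a ω) := by
              simp only [hgdef]; split_ifs <;> linarith
            linarith
        exact this _
    _ = T + ∑ v, ∫ ω, g (D v ω) ∂μ := by
        rw [integral_add (integrable_const T)
          (integrable_finsetSum Finset.univ fun v _ => (hA v).1),
          integral_finsetSum _ (fun v _ => (hA v).1)]
        simp
    _ ≤ T + ∑ v : Fin n, ∑' k, b k := by
        gcongr with v
        exact (hA v).2
    _ = _ := by simp

/-- Lower bound for a fixed size. -/
lemma aux_lower {Ω : Type*} [MeasurableSpace Ω] (μ : Measure Ω) [IsProbabilityMeasure μ] {n : ℕ}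
    (D : Fin n → Ω → ℕ) (hD : ∀ v, Measurable (D v))
    (hi : Integrable (fun ω => ((Finset.univ.sup fun v => D v ω : ℕ) : ℝ)) μ)
    (k : ℕ) (x y p δ : ℝ) (hn : 1 ≤ n) (hp : 0 < p) (hδ : 0 < δ)
    (hx : ∀ v, (μ {ω | D v ω = k}).toReal = x)
    (hy : ∀ v w, v ≠ w → (μ {ω | D v ω = k ∧ D w ω = k}).toReal = y)
    (hxp : |x / p - 1| ≤ δ) (hyp : |y / (p * p) - 1| ≤ δ) (hnp : 1 + δ ≤ δ * (n * p)) :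
    k * (1 - 4 * δ) ≤ ∫ ω, ((Finset.univ.sup fun v => D v ω : ℕ) : ℝ) ∂μ := by
  classical
  set c : ℝ := 1 / (n * p) with hc
  have hn0 : (1 : ℝ) ≤ n := by exact_mod_cast hn
  have hnp0 : 0 < (n : ℝ) * p := by positivity
  set I : Fin n → Ω → ℝ := fun v => Set.indicator {ω | D v ω = k} 1 with hI
  set J : Fin n → Fin n → Ω → ℝ := fun v w => Set.indicator {ω | D v ω = k ∧ D w ω = k} 1 with hJ
  have hmI : ∀ v, MeasurableSet {ω | D v ω = k} := fun v => hD v (measurableSet_singleton k)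
  have hmJ : ∀ v w, MeasurableSet {ω | D v ω = k ∧ D w ω = k} := fun v w => (hmI v).inter (hmI w)
  have hIi : ∀ v, Integrable (I v) μ := fun v =>
    (integrable_const (1 : ℝ)).indicator (hmI v)
  have hJi : ∀ v w, Integrable (J v w) μ := fun v w =>
    (integrable_const (1 : ℝ)).indicator (hmJ v w)
  have hIx : ∀ v, ∫ ω, I v ω ∂μ = x := fun v => by
    rw [hI, integral_indicator_one (hmI v)]; exact hx v
  have hJy : ∀ v w, ∫ ω, J v w ω ∂μ = if v = w then x else y := fun v w => by
    rw [hJ, integral_indicator_one (hmJ v w)]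
    split_ifs with h
    · subst h; simpa [Measure.real] using hx v
    · exact hy v w h
  have hIJ : ∀ v w ω, I v ω * I w ω = J v w ω := fun v w ω => by
    by_cases h1 : D v ω = k <;> by_cases h2 : D w ω = k <;> simp [hI, hJ, h1, h2]
  have hI1 : Integrable (fun ω => ∑ v, I v ω) μ := integrable_finsetSum _ fun v _ => hIi v
  have hJ1 : Integrable (fun ω => ∑ v, ∑ w, J v w ω) μ :=
    integrable_finsetSum _ fun v _ => integrable_finsetSum _ fun w _ => hJi v w
  have hpt : ∀ ω, (k : ℝ) * (2 * c * (∑ v, I v ω) - c ^ 2 * ∑ v, ∑ w, J v w ω) ≤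
      ((Finset.univ.sup fun v => D v ω : ℕ) : ℝ) := by
    intro ω
    have hsq : ∑ v, ∑ w, J v w ω = (∑ v, I v ω) ^ 2 := by
      rw [sq, Finset.sum_mul_sum]
      simp only [hIJ]
    rw [hsq]
    by_cases h : ∃ v, D v ω = k
    · obtain ⟨v, hv⟩ := h
      have h1 : k ≤ (Finset.univ.sup fun v => D v ω : ℕ) := by
        rw [← hv]; exact Finset.le_sup (f := fun v => D v ω) (Finset.mem_univ v)
      have h1' : (k : ℝ) ≤ ((Finset.univ.sup fun v => D v ω : ℕ) : ℝ) := by exact_mod_cast h1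
      refine le_trans ?_ h1'
      have : 2 * c * (∑ v, I v ω) - c ^ 2 * (∑ v, I v ω) ^ 2 ≤ 1 := by
        nlinarith [sq_nonneg (1 - c * ∑ v, I v ω)]
      nlinarith [(Nat.cast_nonneg k : (0:ℝ) ≤ k)]
    · push Not at h
      have : ∑ v, I v ω = 0 := Finset.sum_eq_zero fun v _ => by simp [hI, h v]
      rw [this]; simp
  have hint : ∫ ω, (k : ℝ) * (2 * c * (∑ v, I v ω) - c ^ 2 * ∑ v, ∑ w, J v w ω) ∂μ
      = k * (2 * c * (n * x) - c ^ 2 * (n * x + n * (n - 1) * y)) := by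
    rw [integral_const_mul, integral_sub (hI1.const_mul _) (hJ1.const_mul _),
      integral_const_mul, integral_const_mul, integral_finsetSum _ fun v _ => hIi v,
      integral_finsetSum _ fun v _ => integrable_finsetSum _ fun w _ => hJi v w]
    have : ∀ v, ∫ ω, ∑ w, J v w ω ∂μ = x + (n - 1) * y := fun v => by
      rw [integral_finsetSum _ fun w _ => hJi v w]
      simp only [hJy]
      have : ∀ w, (if v = w then x else y) = (if v = w then x - y else 0) + y := fun w => by
        split_ifs <;> ring
      simp only [this, Finset.sum_add_distrib, Finset.sum_ite_eq]
      simp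
      ring
    simp only [this, hIx]
    simp only [Finset.sum_const, Finset.card_univ, Fintype.card_fin, nsmul_eq_mul]
    ring
  have hmono := integral_mono (((hI1.const_mul (2 * c)).sub (hJ1.const_mul (c ^ 2))).const_mul (k : ℝ))
    hi hpt
  refine le_trans ?_ (hint.symm.le.trans hmono)
  refine mul_le_mul_of_nonneg_left ?_ (Nat.cast_nonneg k)
  rw [abs_le] at hxp hyp
  have hX : x = (x / p) * p := by field_simp
  have hY : y = (y / (p * p)) * (p * p) := by field_simp
  set X := x / p
  set Y := y / (p * p)
  have e : 2 * c * (n * x) - c ^ 2 * (n * x + n * (n - 1) * y)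
      = 2 * X - (X * c + (1 - 1 / n) * Y) := by
    rw [hX, hY, hc]; field_simp
  rw [e]
  have hcpos : 0 < c := by positivity
  have hcd : (1 + δ) * c ≤ δ := by
    rw [hc, mul_one_div, div_le_iff₀ hnp0]; exact hnp
  have h1 : X * c ≤ (1 + δ) * c := by nlinarith
  have hn1 : 0 ≤ 1 - 1 / (n : ℝ) := by
    rw [sub_nonneg, div_le_one (by linarith)]; exact hn0
  have hn2 : 0 < 1 / (n : ℝ) := by positivity
  have h2 : (1 - 1 / (n : ℝ)) * Y ≤ 1 + δ := by nlinarith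
  linarith

/-- Master Theorem (Theorem 1), expectation part:
under the hypotheses (1)–(3) on the degree marginals, the maximum degree
`Δₙ = max_v D_{n,v}` has finite expectation, and `E Δₙ / log n → 1 / log (1/q)`. -/
theorem master_theorem_expectation
    {Ω : ℕ → Type*} [∀ n, MeasurableSpace (Ω n)]
    (μ : ∀ n, Measure (Ω n)) [∀ n, IsProbabilityMeasure (μ n)]
    (D : ∀ n, Fin n → Ω n → ℕ) (hDmeas : ∀ n (v : Fin n), Measurable (D n v))
    (d : ℕ → ℕ → ℝ) (d2 : ℕ → ℕ → ℕ → ℝ)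
    (hd : ∀ n (v : Fin n) (k : ℕ), ((μ n) {ω | D n v ω = k}).toReal = d n k)
    (hd2 : ∀ n (v w : Fin n), v ≠ w → ∀ k ℓ : ℕ,
      ((μ n) {ω | D n v ω = k ∧ D n w ω = ℓ}).toReal = d2 n k ℓ)
    (dbar : ℕ → ℝ) (hdbarpos : ∀ k, 1 ≤ k → 0 < dbar k)
    (q : ℝ) (hq0 : 0 < q) (hq1 : q < 1)
    -- (1): `(log d̄_k)/k → log q`
    (h1 : Tendsto (fun k : ℕ => Real.log (dbar k) / (k : ℝ)) atTop (nhds (Real.log q)))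
    -- (2): uniform asymptotic equivalence in the range `K ≤ k, ℓ ≤ C log n`
    (h2 : ∀ C : ℝ, 0 < C → ∀ δ : ℝ, 0 < δ → ∃ K N : ℕ, ∀ n : ℕ, N ≤ n →
      ∀ k ℓ : ℕ, K ≤ k → (k : ℝ) ≤ C * Real.log n → K ≤ ℓ → (ℓ : ℝ) ≤ C * Real.log n →
        |d n k / dbar k - 1| ≤ δ ∧ |d2 n k ℓ / (dbar k * dbar ℓ) - 1| ≤ δ)
    -- (3): uniform exponential bounds
    (h3 : ∃ M : ℝ, 0 < M ∧ ∃ qbar : ℝ, 0 < qbar ∧ qbar < 1 ∧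
      ∀ n k ℓ : ℕ, 1 ≤ n → 1 ≤ k → 1 ≤ ℓ →
        d n k ≤ M * qbar ^ k ∧ d2 n k ℓ ≤ M * qbar ^ (k + ℓ)) :
    (∀ n : ℕ, 1 ≤ n →
      Integrable (fun ω => ((Finset.univ.sup fun v => D n v ω : ℕ) : ℝ)) (μ n)) ∧
    Tendsto (fun n : ℕ =>
        (∫ ω, ((Finset.univ.sup fun v => D n v ω : ℕ) : ℝ) ∂ (μ n)) / Real.log n)
      atTop (nhds (1 / Real.log (1 / q))) := by
  obtain ⟨M, hM, qbar, hqb0, hqb1, h3⟩ := h3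
  set lam : ℝ := -Real.log q with hlam
  have hlampos : 0 < lam := by have := Real.log_neg hq0 hq1; linarith
  set β : ℝ := -Real.log qbar with hβ
  have hβpos : 0 < β := by have := Real.log_neg hqb0 hqb1; linarith
  have hqpow : ∀ k : ℕ, qbar ^ k = Real.exp (-(β * k)) := fun k => by
    rw [← Real.exp_log hqb0, ← Real.exp_nat_mul, hβ]
    congr 1; ring
  have hL : Tendsto (fun n : ℕ => Real.log (n : ℝ)) atTop atTop :=
    Real.tendsto_log_atTop.comp tendsto_natCast_atTop_atTop
  have hint : ∀ n : ℕ, 1 ≤ n →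
      Integrable (fun ω => ((Finset.univ.sup fun v => D n v ω : ℕ) : ℝ)) (μ n) := by
    intro n hn
    refine aux_sup_integrable (μ n) (D n) (hDmeas n) fun v => ?_
    refine (aux_nat_bound (μ n) (D n v) (hDmeas n v) (fun k => (k : ℝ))
      (fun k => M * (k * Real.exp (-(β * k)))) (fun k => Nat.cast_nonneg k) (fun k => ?_)
      ((aux_summable β hβpos).mul_left M)).1
    rcases Nat.eq_zero_or_pos k with rfl | hk
    · simp
    · rw [hd n v k]
      have := (h3 n k k hn hk hk).1
      rw [hqpow] at this
      calc (k : ℝ) * d n k ≤ k * (M * Real.exp (-(β * k))) := by gcongr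
        _ = _ := by ring
  refine ⟨hint, ?_⟩
  have hlim : 1 / Real.log (1 / q) = 1 / lam := by
    rw [one_div q, Real.log_inv]
  rw [hlim]
  -- upper bound
  have hupper : ∀ t : ℝ, 1 / lam < t → ∃ B : ℝ, ∀ᶠ n : ℕ in atTop,
      (∫ ω, ((Finset.univ.sup fun v => D n v ω : ℕ) : ℝ) ∂ (μ n)) ≤ t * Real.log n + B := by
    intro t ht
    have ht0 : 0 < t := lt_trans (by positivity) ht
    have ht1 : 1 / t < lam := by
      rw [div_lt_iff₀ ht0]; rw [div_lt_iff₀ hlampos] at ht; linarith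
    obtain ⟨ρ, hρ1, hρ2⟩ := exists_between ht1
    obtain ⟨K, N, hKN⟩ := h2 (2 / β) (by positivity) 1 one_pos
    have hev : ∀ᶠ k : ℕ in atTop, Real.log (dbar k) / (k : ℝ) < -ρ :=
      h1.eventually_lt_const (by linarith)
    obtain ⟨K1, hK1⟩ := eventually_atTop.1 hev
    set h : ℕ → ℝ := fun k => 2 * (k * Real.exp (-((ρ - 1 / t) * k)))
      + M * (k * Real.exp (-(β / 2 * k))) with hh
    have hs : Summable h := ((aux_summable _ (by linarith)).mul_left 2).add
      ((aux_summable _ (by positivity)).mul_left M)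
    refine ⟨∑' k, h k, ?_⟩
    filter_upwards [eventually_ge_atTop N, eventually_ge_atTop 1,
      hL.eventually_ge_atTop (max 0 ((K + K1 + 1 : ℝ) / t))] with n hnN hn1 hnL
    have hn0 : (0 : ℝ) < n := by exact_mod_cast hn1
    have hL0 : 0 ≤ Real.log n := le_trans (le_max_left _ _) hnL
    have hLK : (K + K1 + 1 : ℝ) ≤ t * Real.log n := by
      have := le_trans (le_max_right _ _) hnL
      rw [div_le_iff₀ ht0] at this; linarith
    have hexp : Real.exp (-Real.log n) = 1 / n := by
      rw [Real.exp_neg, Real.exp_log hn0, one_div]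
    have hh0 : ∀ k, 0 ≤ h k := fun k => by simp only [hh]; positivity
    have := aux_upper (μ n) (D n) (hDmeas n) (hint n hn1) (t * Real.log n) (by positivity)
      (fun k => 1 / n * h k) (hs.mul_left _) (fun k => mul_nonneg (by positivity) (hh0 k)) ?_
    · rw [tsum_mul_left] at this
      refine this.trans (le_of_eq ?_)
      field_simp
    · intro v k hk
      rw [hd n v k]
      have hkK : (K + K1 + 1 : ℝ) < k := by linarith
      have hkK' : K + K1 + 1 < k := by exact_mod_cast hkK
      have hk0 : (0 : ℝ) < k := by exact_mod_cast (by omega : 0 < k)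
      by_cases hc : (k : ℝ) ≤ 2 / β * Real.log n
      · have hq := (hKN n hnN k k (by omega) hc (by omega) hc).1
        have hdb := hdbarpos k (by omega)
        have h4 : d n k ≤ 2 * dbar k := by
          have := (abs_le.1 hq).2
          have : d n k / dbar k ≤ 2 := by linarith
          rwa [div_le_iff₀ hdb] at this
        have h5 : dbar k ≤ Real.exp (-(ρ * k)) := by
          have := hK1 k (by omega)
          rw [div_lt_iff₀ hk0] at this
          rw [← Real.log_le_iff_le_exp hdb]; linarith
        have h6 : Real.exp (-(ρ * k)) ≤ 1 / n * Real.exp (-((ρ - 1 / t) * k)) := by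
          rw [← hexp, ← Real.exp_add]
          apply Real.exp_le_exp.2
          have : Real.log n ≤ 1 / t * k := by
            rw [one_div, ← div_eq_inv_mul, le_div_iff₀ ht0]; linarith
          linarith
        calc (k : ℝ) * d n k ≤ k * (2 * (1 / n * Real.exp (-((ρ - 1 / t) * k)))) := by
              gcongr; linarith
          _ = 1 / n * (2 * (k * Real.exp (-((ρ - 1 / t) * k)))) := by ring
          _ ≤ 1 / n * h k := by
              gcongr; simp only [hh]
              have : 0 ≤ M * (k * Real.exp (-(β / 2 * k))) := by positivity
              linarith
      · push Not at hc
        have h4 := (h3 n k k hn1 (by omega) (by omega)).1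
        rw [hqpow] at h4
        have h6 : Real.exp (-(β * k)) ≤ 1 / n * Real.exp (-(β / 2 * k)) := by
          rw [← hexp, ← Real.exp_add]
          apply Real.exp_le_exp.2
          have : Real.log n ≤ β / 2 * k := by
            have h7 : β / 2 * (2 / β * Real.log n) = Real.log n := by field_simp
            rw [← h7]; gcongr
          linarith
        calc (k : ℝ) * d n k ≤ k * (M * (1 / n * Real.exp (-(β / 2 * k)))) := by
              gcongr; exact h4.trans (by gcongr)
          _ = 1 / n * (M * (k * Real.exp (-(β / 2 * k)))) := by ring
          _ ≤ 1 / n * h k := by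
              gcongr; simp only [hh]
              have : 0 ≤ 2 * (k * Real.exp (-((ρ - 1 / t) * k))) := by positivity
              linarith
  -- lower bound
  have hlower : ∀ t : ℝ, 0 < t → t < 1 / lam → ∀ δ : ℝ, 0 < δ → ∀ᶠ n : ℕ in atTop,
      (⌊t * Real.log n⌋₊ : ℝ) * (1 - 4 * δ) ≤
        ∫ ω, ((Finset.univ.sup fun v => D n v ω : ℕ) : ℝ) ∂ (μ n) := by
    intro t ht0 ht δ hδ
    have ht1 : lam < 1 / t := by
      rw [lt_div_iff₀ ht0]; rw [lt_div_iff₀ hlampos] at ht; linarith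
    obtain ⟨ρ, hρ1, hρ2⟩ := exists_between ht1
    have hρ0 : 0 < ρ := hlampos.trans hρ1
    have hρt : 0 < 1 - ρ * t := by rw [lt_div_iff₀ ht0] at hρ2; linarith
    obtain ⟨K, N, hKN⟩ := h2 t ht0 δ hδ
    have hev : ∀ᶠ k : ℕ in atTop, -ρ < Real.log (dbar k) / (k : ℝ) :=
      h1.eventually_const_lt (by linarith)
    obtain ⟨K1, hK1⟩ := eventually_atTop.1 hev
    have hbig : Tendsto (fun n : ℕ => Real.exp ((1 - ρ * t) * Real.log n)) atTop atTop :=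
      Real.tendsto_exp_atTop.comp (hL.const_mul_atTop hρt)
    have hfl : Tendsto (fun n : ℕ => ⌊t * Real.log n⌋₊) atTop atTop :=
      tendsto_nat_floor_atTop.comp (hL.const_mul_atTop ht0)
    filter_upwards [eventually_ge_atTop N, eventually_ge_atTop 1, hL.eventually_ge_atTop 0,
      hbig.eventually_ge_atTop ((1 + δ) / δ), hfl.eventually_ge_atTop (K + K1 + 1)]
      with n hnN hn1 hL0 hnb hk
    have hkle : (⌊t * Real.log n⌋₊ : ℝ) ≤ t * Real.log n := Nat.floor_le (by positivity)
    set k := ⌊t * Real.log n⌋₊ with hkdef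
    have hn0 : (0 : ℝ) < n := by exact_mod_cast hn1
    have hk0 : (0 : ℝ) < k := by exact_mod_cast (by omega : 0 < k)
    have hdb := hdbarpos k (by omega)
    obtain ⟨hx, hy⟩ := hKN n hnN k k (by omega) hkle (by omega) hkle
    refine aux_lower (μ n) (D n) (hDmeas n) (hint n hn1) k (d n k) (d2 n k k) (dbar k) δ hn1 hdb hδ
      (fun v => hd n v k) (fun v w hvw => hd2 n v w hvw k k) hx hy ?_
    have h5 : Real.exp (-(ρ * k)) ≤ dbar k := by
      have := hK1 k (by omega)
      rw [lt_div_iff₀ hk0] at this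
      rw [← Real.le_log_iff_exp_le hdb]; linarith
    have h6 : Real.exp ((1 - ρ * t) * Real.log n) ≤ n * dbar k := by
      calc Real.exp ((1 - ρ * t) * Real.log n)
          = Real.exp (Real.log n) * Real.exp (-(ρ * (t * Real.log n))) := by
            rw [← Real.exp_add]; congr 1; ring
        _ ≤ n * Real.exp (-(ρ * k)) := by
            rw [Real.exp_log hn0]; gcongr
        _ ≤ _ := by gcongr
    have h7 := hnb.trans h6
    rw [div_le_iff₀ hδ] at h7
    linarith
  refine tendsto_order.2 ⟨fun u hu => ?_, fun u hu => ?_⟩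
  · have hmax : max u 0 < 1 / lam := max_lt hu (by positivity)
    obtain ⟨t, ht1, ht2⟩ := exists_between hmax
    have ht0 : 0 < t := lt_of_le_of_lt (le_max_right _ _) ht1
    have hut : u < t := lt_of_le_of_lt (le_max_left _ _) ht1
    obtain ⟨r, hr1, hr2⟩ := exists_between ht1
    have hr0 : 0 < r := lt_of_le_of_lt (le_max_right _ _) hr1
    have hur : u < r := lt_of_le_of_lt (le_max_left _ _) hr1
    -- `1 - 4 δ = r / t`
    have hrt : r / t < 1 := (div_lt_one ht0).2 hr2
    filter_upwards [hlower t ht0 ht2 ((1 - r / t) / 4) (by linarith),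
      hL.eventually_gt_atTop (max 0 (r / t / (r - u)))] with n hn hnL
    have hL0 : 0 < Real.log n := lt_of_le_of_lt (le_max_left _ _) hnL
    have hL1 := lt_of_le_of_lt (le_max_right _ _) hnL
    rw [div_lt_iff₀ (by linarith)] at hL1
    rw [lt_div_iff₀ hL0]
    refine lt_of_lt_of_le ?_ hn
    have hf := Nat.lt_floor_add_one (t * Real.log n)
    have e : 1 - 4 * ((1 - r / t) / 4) = r / t := by ring
    rw [e]
    have hrt0 : 0 < r / t := by positivity
    have h8 : (t * Real.log n - 1) * (r / t) ≤ (⌊t * Real.log n⌋₊ : ℝ) * (r / t) := by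
      gcongr; linarith
    have h9 : (t * Real.log n - 1) * (r / t) = r * Real.log n - r / t := by field_simp
    linarith
  · obtain ⟨t, ht1, ht2⟩ := exists_between hu
    obtain ⟨B, hB⟩ := hupper t ht1
    filter_upwards [hB, hL.eventually_gt_atTop (max 0 (B / (u - t)))] with n hn hnL
    have hL0 : 0 < Real.log n := lt_of_le_of_lt (le_max_left _ _) hnL
    have hL1 := lt_of_le_of_lt (le_max_right _ _) hnL
    rw [div_lt_iff₀ (by linarith)] at hL1
    rw [div_lt_iff₀ hL0]
    linarith
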